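/- Computation of the real log canonical threshold of the monomial function K_3(v) = Σ_{ℓ=1}^{L-1} δ_ℓ^2 + a^2 Σ_{ℓ=1}^{L-1} β_ℓ^4 with bounded positive prior near the origin: the largest pole of the zeta function ζ(z) = ∫_{[0,ε]^{2L-1}} K_3(v)^z dv is at z = −λ with λ = (L−1)/2 + min(1/2, (L−1)/4), and its order is 2 if L = 3 and 1 otherwise. -/

import Mathlib

open Finset MeasureTheory Filter

/-- the cube `[0,ε]^n` -/
def cube (n : ℕ) (ε : ℝ) : Set (Fin n → ℝ) := Set.univ.pi fun _ => Set.Icc 0 ε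

lemma mem_cube {n : ℕ} {ε : ℝ} {x : Fin n → ℝ} : x ∈ cube n ε ↔ ∀ i, x i ∈ Set.Icc 0 ε := by
  simp only [cube, Set.mem_univ_pi]

lemma isCompact_cube (n : ℕ) (ε : ℝ) : IsCompact (cube n ε) :=
  isCompact_univ_pi fun _ => isCompact_Icc

lemma meas_cube (n : ℕ) (ε : ℝ) : MeasurableSet (cube n ε) :=
  (isCompact_cube n ε).measurableSet

open scoped Pointwise in
lemma smul_cube (n : ℕ) (x R : ℝ) (hR : 0 < R) : R • cube n x = cube n (R * x) := by
  ext y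
  rw [Set.mem_smul_set_iff_inv_smul_mem₀ hR.ne', mem_cube, mem_cube]
  refine forall_congr' fun i => ?_
  simp only [Pi.smul_apply, smul_eq_mul, Set.mem_Icc]
  rw [inv_mul_le_iff₀ hR]
  refine and_congr_left fun _ => ?_
  constructor
  · intro h
    have := mul_nonneg hR.le h
    rwa [mul_inv_cancel_left₀ hR.ne'] at this
  · intro h; positivity

lemma volume_cube (n : ℕ) (ε : ℝ) : volume (cube n ε) = ENNReal.ofReal ε ^ n := by
  rw [cube, volume_pi_pi]; simp

lemma cube_restrict (n : ℕ) (ε : ℝ) : (volume : Measure (Fin n → ℝ)).restrict (cube n ε)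
    = Measure.pi fun _ => volume.restrict (Set.Icc 0 ε) := by
  rw [volume_pi, cube, Measure.restrict_pi_pi]

instance (n : ℕ) (ε : ℝ) : IsFiniteMeasure ((volume : Measure (Fin n → ℝ)).restrict (cube n ε)) :=
  ⟨by rw [Measure.restrict_apply_univ]; exact (isCompact_cube n ε).measure_lt_top⟩

lemma icc_pos (ε : ℝ) : ∀ᵐ a ∂(volume.restrict (Set.Icc 0 ε)), 0 < a ∧ a ≤ ε := by
  have h1 : ∀ᵐ a ∂(volume.restrict (Set.Icc 0 ε)), a ∈ Set.Icc 0 ε :=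
    ae_restrict_mem measurableSet_Icc
  have h2 : ∀ᵐ a ∂(volume.restrict (Set.Icc 0 ε)), a ≠ (0 : ℝ) := by
    refine ae_restrict_of_ae ?_
    simp [ae_iff]
  filter_upwards [h1, h2] with a h1 h2
  exact ⟨lt_of_le_of_ne h1.1 h2.symm, h1.2⟩

lemma cube_pos (n : ℕ) (ε : ℝ) :
    ∀ᵐ x ∂((volume : Measure (Fin n → ℝ)).restrict (cube n ε)), ∀ i, 0 < x i ∧ x i ≤ ε := by
  have h1 := ae_restrict_mem (μ := volume) (meas_cube n ε)
  have h2 : ∀ᵐ x ∂((volume : Measure (Fin n → ℝ)).restrict (cube n ε)), ∀ i, x i ≠ 0 := by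
    refine ae_restrict_of_ae ?_
    rw [ae_all_iff]
    intro i
    exact Measure.ae_eval_ne (fun _ => volume) i 0
  filter_upwards [h1, h2] with a h1 h2 i
  have := mem_cube.1 h1 i
  exact ⟨lt_of_le_of_ne this.1 (h2 i).symm, this.2⟩

lemma icc_int (ε q : ℝ) (hε : 0 < ε) (hq : q < 1) :
    Integrable (fun a : ℝ => a ^ (-q)) (volume.restrict (Set.Icc 0 ε)) := by
  have h := intervalIntegral.intervalIntegrable_rpow' (a := 0) (b := ε) (r := -q) (by linarith)
  rw [intervalIntegrable_iff_integrableOn_Icc_of_le hε.le] at h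
  exact h

lemma cube_int (n : ℕ) (ε q : ℝ) (hε : 0 < ε) (hq : q < 1) :
    Integrable (fun x : Fin n → ℝ => ∏ i, x i ^ (-q)) (volume.restrict (cube n ε)) := by
  rw [cube_restrict]
  exact Integrable.fintype_prod (f := fun _ a => a ^ (-q)) fun i => icc_int ε q hε hq

/-- product bound -/
lemma prod_bound (n : ℕ) (x : Fin n → ℝ) (B w : ℝ) (hx : ∀ i, 0 < x i) (hB : ∀ i, x i ≤ B)
    (hB0 : 0 < B) (hw : 0 ≤ w) : B ^ (-(n * w)) ≤ ∏ i, x i ^ (-w) := by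
  have : B ^ (-(n * w)) = ∏ _i : Fin n, B ^ (-w) := by
    rw [Finset.prod_const, ← Real.rpow_natCast, ← Real.rpow_mul hB0.le]
    congr 1; simp; ring
  rw [this]
  refine Finset.prod_le_prod (fun i _ => by positivity) fun i _ => ?_
  exact Real.rpow_le_rpow_of_nonpos (hx i) (hB i) (by linarith)

/-- sum of fourth powers -/
def quart {n : ℕ} (x : Fin n → ℝ) : ℝ := ∑ i, x i ^ 4

/-- sum of squares -/
def sqs {n : ℕ} (x : Fin n → ℝ) : ℝ := ∑ i, x i ^ 2

lemma quart_cont (n : ℕ) : Continuous (quart (n := n)) := by unfold quart; fun_prop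
lemma sqs_cont (n : ℕ) : Continuous (sqs (n := n)) := by unfold sqs; fun_prop
lemma quart_nonneg {n : ℕ} (x : Fin n → ℝ) : 0 ≤ quart x := by unfold quart; positivity
lemma sqs_nonneg {n : ℕ} (x : Fin n → ℝ) : 0 ≤ sqs x := by unfold sqs; positivity
lemma le_quart {n : ℕ} (x : Fin n → ℝ) (i : Fin n) : x i ^ 4 ≤ quart x :=
  Finset.single_le_sum (f := fun i => x i ^ 4) (fun i _ => by positivity) (Finset.mem_univ i)
lemma le_sqs {n : ℕ} (x : Fin n → ℝ) (i : Fin n) : x i ^ 2 ≤ sqs x :=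
  Finset.single_le_sum (f := fun i => x i ^ 2) (fun i _ => by positivity) (Finset.mem_univ i)
lemma quart_smul {n : ℕ} (x : Fin n → ℝ) (R : ℝ) : quart (R • x) = R ^ 4 * quart x := by
  simp [quart, mul_pow, Finset.mul_sum]
lemma sqs_smul {n : ℕ} (x : Fin n → ℝ) (R : ℝ) : sqs (R • x) = R ^ 2 * sqs x := by
  simp [sqs, mul_pow, Finset.mul_sum]
lemma quart_pos {n : ℕ} (hn : 1 ≤ n) (x : Fin n → ℝ) (hx : ∀ i, 0 < x i) : 0 < quart x :=
  lt_of_lt_of_le (by have := hx ⟨0, hn⟩; positivity) (le_quart x ⟨0, hn⟩)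

lemma pow_rpow_neg (x w : ℝ) (k : ℕ) (hx : 0 ≤ x) : (x ^ k) ^ (-w) = x ^ (-(k * w)) := by
  rw [← Real.rpow_natCast, ← Real.rpow_mul hx]; congr 1; ring

lemma quart_bound {n : ℕ} (hn : 1 ≤ n) (x : Fin n → ℝ) (hx : ∀ i, 0 < x i) (q : ℝ) (hq : 0 ≤ q) :
    quart x ^ (-q) ≤ ∏ i, x i ^ (-(4 * q / n)) := by
  have hn' : (0 : ℝ) < n := by exact_mod_cast hn
  have := prod_bound n (fun i => x i ^ 4) (quart x) (q / n) (fun i => pow_pos (hx i) _)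
    (le_quart x) (quart_pos hn x hx) (by positivity)
  rw [mul_div_cancel₀ _ hn'.ne'] at this
  refine this.trans (le_of_eq ?_)
  refine Finset.prod_congr rfl fun i _ => ?_
  rw [pow_rpow_neg _ _ _ (hx i).le]; congr 1; push_cast; ring

lemma quart_int (n : ℕ) (hn : 1 ≤ n) (ε t : ℝ) (hε : 0 < ε) (ht : 0 ≤ t) (ht' : t < n / 4) :
    Integrable (fun x : Fin n → ℝ => quart x ^ (-t)) (volume.restrict (cube n ε)) := by
  have hn' : (0 : ℝ) < n := by exact_mod_cast hn
  refine (cube_int n ε (4 * t / n) hε (by rw [div_lt_one hn']; linarith)).mono' ?_ ?_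
  · exact ((quart_cont n).measurable.pow_const _).aestronglyMeasurable
  · filter_upwards [cube_pos n ε] with x hx
    rw [Real.norm_of_nonneg (Real.rpow_nonneg (quart_nonneg x) _)]
    exact quart_bound hn x (fun i => (hx i).1) t ht

/-- the main function -/
def KK {n : ℕ} (v : ℝ × (Fin n → ℝ) × (Fin n → ℝ)) : ℝ := sqs v.2.1 + v.1 ^ 2 * quart v.2.2

/-- the flat prior on the box -/
noncomputable def bm (n : ℕ) (ε : ℝ) : Measure (ℝ × (Fin n → ℝ) × (Fin n → ℝ)) :=
  (volume.restrict (Set.Icc 0 ε)).prod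
    ((volume.restrict (cube n ε)).prod (volume.restrict (cube n ε)))

lemma KK_cont (n : ℕ) : Continuous (KK (n := n)) := by
  have := quart_cont n
  have := sqs_cont n
  unfold KK; fun_prop

lemma KK_nonneg {n : ℕ} (v : ℝ × (Fin n → ℝ) × (Fin n → ℝ)) : 0 ≤ KK v := by
  have := quart_nonneg v.2.2
  have := sqs_nonneg v.2.1
  unfold KK; positivity

lemma bm_eq (n : ℕ) (ε : ℝ) : bm n ε
    = volume.restrict (Set.Icc 0 ε ×ˢ (cube n ε ×ˢ cube n ε)) := by
  rw [bm, Measure.prod_restrict, Measure.prod_restrict]; rfl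

instance (n : ℕ) (ε : ℝ) : IsFiniteMeasure (bm n ε) := by unfold bm; infer_instance

lemma bm_mem (n : ℕ) (ε : ℝ) : ∀ᵐ v ∂(bm n ε), v ∈ Set.Icc 0 ε ×ˢ (cube n ε ×ˢ cube n ε) := by
  rw [bm_eq]
  exact ae_restrict_mem (measurableSet_Icc.prod ((meas_cube n ε).prod (meas_cube n ε)))

lemma bm_pos (n : ℕ) (ε : ℝ) : ∀ᵐ v ∂(bm n ε), 0 < v.1 ∧ (∀ i, 0 < v.2.1 i) ∧ ∀ i, 0 < v.2.2 i := by
  have h1 : ∀ᵐ v ∂(bm n ε), 0 < v.1 ∧ v.1 ≤ ε := Measure.quasiMeasurePreserving_fst.ae (icc_pos ε)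
  have h2 : ∀ᵐ v ∂(bm n ε), ∀ i, 0 < v.2.1 i ∧ v.2.1 i ≤ ε :=
    (Measure.quasiMeasurePreserving_fst.comp Measure.quasiMeasurePreserving_snd).ae (cube_pos n ε)
  have h3 : ∀ᵐ v ∂(bm n ε), ∀ i, 0 < v.2.2 i ∧ v.2.2 i ≤ ε :=
    (Measure.quasiMeasurePreserving_snd.comp Measure.quasiMeasurePreserving_snd).ae (cube_pos n ε)
  filter_upwards [h1, h2, h3] with v h1 h2 h3
  exact ⟨h1.1, fun i => (h2 i).1, fun i => (h3 i).1⟩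

lemma KK_bdd (n : ℕ) (ε : ℝ) : ∃ M : ℝ, 1 ≤ M ∧ ∀ᵐ v ∂(bm n ε), KK v ≤ M := by
  have hc : IsCompact (Set.Icc 0 ε ×ˢ (cube n ε ×ˢ cube n ε)) :=
    isCompact_Icc.prod ((isCompact_cube n ε).prod (isCompact_cube n ε))
  obtain ⟨M, hM⟩ := hc.bddAbove_image (KK_cont n).continuousOn
  refine ⟨max M 1, le_max_right _ _, ?_⟩
  filter_upwards [bm_mem n ε] with v hv
  exact le_max_of_le_left (hM ⟨v, hv, rfl⟩)

lemma KK_meas (n : ℕ) (ε z : ℝ) : AEStronglyMeasurable (fun v => KK v ^ z) (bm n ε) :=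
  ((KK_cont n).measurable.pow_const _).aestronglyMeasurable

/-- the threshold -/
noncomputable def mu0 (n : ℕ) : ℝ := min (1 / 2) ((n : ℝ) / 4)

lemma mu0_pos {n : ℕ} (hn : 1 ≤ n) : 0 < mu0 n := by
  have hn' : (0 : ℝ) < n := by exact_mod_cast hn
  unfold mu0; positivity

lemma KK_int (n : ℕ) (hn : 1 ≤ n) (ε z : ℝ) (hε : 0 < ε) (hz : -(n / 2 + mu0 n) < z) :
    Integrable (fun v => KK v ^ z) (bm n ε) := by
  have hn' : (0 : ℝ) < n := by exact_mod_cast hn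
  have hm := mu0_pos hn
  have hm1 : mu0 n ≤ 1 / 2 := min_le_left _ _
  have hm2 : mu0 n ≤ n / 4 := min_le_right _ _
  rcases le_or_gt 0 z with h0 | h0
  · obtain ⟨M, hM1, hM⟩ := KK_bdd n ε
    refine (integrable_const (M ^ z)).mono' (KK_meas n ε z) ?_
    filter_upwards [hM] with v hv
    rw [Real.norm_of_nonneg (Real.rpow_nonneg (KK_nonneg v) _)]
    exact Real.rpow_le_rpow (KK_nonneg v) hv h0
  · set lam : ℝ := n / 2 + mu0 n with hlam
    have hl : 0 < lam := by positivity
    obtain ⟨r, hr⟩ : ∃ r, r = -z / lam := ⟨_, rfl⟩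
    have hr0 : 0 < r := by rw [hr]; apply div_pos <;> linarith
    have hr1 : r < 1 := by rw [hr, div_lt_one hl]; linarith
    have hrz : z = -(n * (r / 2)) + -(r * mu0 n) := by
      have : r * lam = -z := by rw [hr]; field_simp
      rw [hlam] at this; linarith
    have hrm : r * mu0 n < mu0 n := by nlinarith
    have hint := (icc_int ε (2 * (r * mu0 n)) hε (by linarith)).mul_prod
      ((cube_int n ε r hε hr1).mul_prod (cube_int n ε (4 * (r * mu0 n) / n) hε
        (by rw [div_lt_one hn']; linarith)))
    refine Integrable.mono' hint (KK_meas n ε z) ?_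
    filter_upwards [bm_pos n ε] with v hv
    obtain ⟨h1, h2, h3⟩ := hv
    have hq := quart_pos hn v.2.2 h3
    have hs := sqs_nonneg v.2.1
    have hK : 0 < KK v := by unfold KK; positivity
    rw [Real.norm_of_nonneg (Real.rpow_nonneg (KK_nonneg v) _), hrz, Real.rpow_add hK]
    have e1 : KK v ^ (-(n * (r / 2))) ≤ ∏ i, v.2.1 i ^ (-r) := by
      refine (prod_bound n (fun i => v.2.1 i ^ 2) (KK v) (r / 2) (fun i => pow_pos (h2 i) _)
        (fun i => (le_sqs v.2.1 i).trans ?_) hK (by positivity)).trans (le_of_eq ?_)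
      · unfold KK; have : 0 ≤ v.1 ^ 2 * quart v.2.2 := by positivity
        linarith
      · refine Finset.prod_congr rfl fun i _ => ?_
        rw [pow_rpow_neg _ _ _ (h2 i).le]; congr 1; push_cast; ring
    have e2 : KK v ^ (-(r * mu0 n)) ≤
        v.1 ^ (-(2 * (r * mu0 n))) * ∏ i, v.2.2 i ^ (-(4 * (r * mu0 n) / n)) := by
      have : KK v ^ (-(r * mu0 n)) ≤ (v.1 ^ 2 * quart v.2.2) ^ (-(r * mu0 n)) := by
        refine Real.rpow_le_rpow_of_nonpos (by positivity) ?_ ?_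
        · unfold KK; linarith
        · have : 0 ≤ r * mu0 n := by positivity
          linarith
      refine this.trans ?_
      rw [Real.mul_rpow (by positivity) hq.le, pow_rpow_neg _ _ _ h1.le]
      push_cast
      exact mul_le_mul_of_nonneg_left (quart_bound hn _ h3 _ (by positivity))
        (Real.rpow_nonneg h1.le _)
    calc _ ≤ _ := mul_le_mul e1 e2 (Real.rpow_nonneg hK.le _)
          (Finset.prod_nonneg fun i _ => Real.rpow_nonneg (h2 i).le _)
      _ = _ := by ring

lemma norm_sq_le_sqs {n : ℕ} (u : Fin n → ℝ) : ‖u‖ ^ 2 ≤ sqs u := by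
  have h : ‖u‖ ≤ √(sqs u) := by
    rw [pi_norm_le_iff_of_nonneg (Real.sqrt_nonneg _)]
    intro i
    exact Real.abs_le_sqrt (le_sqs u i)
  calc ‖u‖ ^ 2 ≤ √(sqs u) ^ 2 := by gcongr
    _ = sqs u := Real.sq_sqrt (sqs_nonneg u)

lemma jap_meas (n : ℕ) (s : ℝ) : Measurable (fun u : Fin n → ℝ => (1 + sqs u) ^ (-s)) :=
  ((measurable_const.add (sqs_cont n).measurable).pow_const _)

lemma jap_nonneg {n : ℕ} (s : ℝ) (u : Fin n → ℝ) : 0 ≤ (1 + sqs u) ^ (-s) :=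
  Real.rpow_nonneg (by have := sqs_nonneg u; linarith) _

lemma jap_pos {n : ℕ} (s : ℝ) (u : Fin n → ℝ) : 0 < (1 + sqs u) ^ (-s) :=
  Real.rpow_pos_of_pos (by have := sqs_nonneg u; linarith) _

lemma jap_int (n : ℕ) (s : ℝ) (hs : n / 2 < s) :
    Integrable (fun u : Fin n → ℝ => (1 + sqs u) ^ (-s)) := by
  have h := integrable_rpow_neg_one_add_norm_sq (E := Fin n → ℝ) (μ := volume) (r := 2 * s)
    (by simp; linarith)
  refine h.mono' (jap_meas n s).aestronglyMeasurable (Eventually.of_forall fun u => ?_)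
  rw [Real.norm_of_nonneg (jap_nonneg s u)]
  have e : -(2 * s) / 2 = -s := by ring
  rw [e]
  have hn : (0 : ℝ) ≤ n := by positivity
  refine Real.rpow_le_rpow_of_nonpos (by positivity) ?_ (by linarith)
  have := norm_sq_le_sqs u
  linarith

/-- rescaled inner integral -/
noncomputable def gg (n : ℕ) (ε s c : ℝ) : ℝ := ∫ u in cube n (ε / √c), (1 + sqs u) ^ (-s)

lemma gg_nonneg (n : ℕ) (ε s c : ℝ) : 0 ≤ gg n ε s c :=
  integral_nonneg fun u => jap_nonneg s u

lemma jap_mono {n : ℕ} (u : Fin n → ℝ) {s1 s : ℝ} (h : s1 ≤ s) :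
    (1 + sqs u) ^ (-s) ≤ (1 + sqs u) ^ (-s1) :=
  Real.rpow_le_rpow_of_exponent_le (by have := sqs_nonneg u; linarith) (by linarith)

lemma gg_le (n : ℕ) (ε s s1 c : ℝ) (h1 : n / 2 < s1) (h : s1 ≤ s) :
    gg n ε s c ≤ ∫ u : Fin n → ℝ, (1 + sqs u) ^ (-s1) := by
  calc gg n ε s c ≤ ∫ u : Fin n → ℝ, (1 + sqs u) ^ (-s) :=
        setIntegral_le_integral (jap_int n s (by linarith))
          (Eventually.of_forall fun u => jap_nonneg s u)
    _ ≤ _ := integral_mono (jap_int n s (by linarith)) (jap_int n s1 h1) fun u => jap_mono u h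

/-- the positive orthant -/
def orth (n : ℕ) : Set (Fin n → ℝ) := {u | ∀ i, 0 ≤ u i}

lemma meas_orth (n : ℕ) : MeasurableSet (orth n) := by
  unfold orth
  have : IsClosed {u : Fin n → ℝ | ∀ i, 0 ≤ u i} := by
    simp only [Set.ofPred_forall]
    exact isClosed_iInter fun i => isClosed_le continuous_const (continuous_apply i)
  exact this.measurableSet

/-- limit constant -/
noncomputable def G0 (n : ℕ) (s : ℝ) : ℝ := ∫ u in orth n, (1 + sqs u) ^ (-s)

lemma G0_pos (n : ℕ) (s : ℝ) (hs : n / 2 < s) : 0 < G0 n s := by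
  unfold G0
  rw [setIntegral_pos_iff_support_of_nonneg_ae (Eventually.of_forall fun u => jap_nonneg s u)
    (jap_int n s hs).integrableOn]
  have : cube n 1 ⊆ Function.support (fun u : Fin n → ℝ => (1 + sqs u) ^ (-s)) ∩ orth n := by
    intro u hu
    exact ⟨(jap_pos s u).ne', fun i => (mem_cube.1 hu i).1⟩
  refine lt_of_lt_of_le ?_ (measure_mono this)
  rw [volume_cube]; simp

lemma gg_tendsto (n : ℕ) (ε s0 : ℝ) (hε : 0 < ε) (hs : n / 2 < s0) :
    Tendsto (fun p : ℝ × ℝ => gg n ε p.1 p.2) (nhds s0 ×ˢ nhdsWithin 0 (Set.Ioi 0))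
      (nhds (G0 n s0)) := by
  have e1 : ∀ p : ℝ × ℝ, gg n ε p.1 p.2 =
      ∫ u, (cube n (ε / √p.2)).indicator (fun u => (1 + sqs u) ^ (-p.1)) u := fun p => by
    rw [integral_indicator (meas_cube _ _)]; rfl
  have e2 : G0 n s0 = ∫ u, (orth n).indicator (fun u => (1 + sqs u) ^ (-s0)) u := by
    rw [integral_indicator (meas_orth _)]; rfl
  simp_rw [e1]; rw [e2]
  obtain ⟨s1, hs1, hs1'⟩ := exists_between hs
  refine tendsto_integral_filter_of_dominated_convergence (fun u => (1 + sqs u) ^ (-s1)) ?_ ?_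
    (jap_int n s1 hs1) ?_
  · exact Eventually.of_forall fun p =>
      ((jap_meas n p.1).indicator (meas_cube _ _)).aestronglyMeasurable
  · have : ∀ᶠ p : ℝ × ℝ in nhds s0 ×ˢ nhdsWithin 0 (Set.Ioi 0), s1 < p.1 :=
      tendsto_fst.eventually (lt_mem_nhds hs1')
    filter_upwards [this] with p hp
    refine Eventually.of_forall fun u => ?_
    rw [Real.norm_of_nonneg (Set.indicator_nonneg (fun u _ => jap_nonneg _ u) _)]
    exact (Set.indicator_le_self' (fun u _ => jap_nonneg _ u) u).trans (jap_mono u hp.le)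
  · refine Eventually.of_forall fun u => ?_
    by_cases hu : u ∈ orth n
    · rw [Set.indicator_of_mem hu]
      have hdiv : Tendsto (fun p : ℝ × ℝ => ε / √p.2) (nhds s0 ×ˢ nhdsWithin 0 (Set.Ioi 0))
          atTop := by
        have h1 : Tendsto (fun c : ℝ => √c) (nhdsWithin 0 (Set.Ioi 0))
            (nhdsWithin 0 (Set.Ioi 0)) := by
          refine tendsto_nhdsWithin_of_tendsto_nhds_of_eventually_within _ ?_ ?_
          · have := Real.continuous_sqrt.tendsto 0
            rw [Real.sqrt_zero] at this
            exact this.mono_left nhdsWithin_le_nhds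
          · filter_upwards [self_mem_nhdsWithin] with c hc
            exact Real.sqrt_pos.2 hc
        have h2 := (tendsto_inv_nhdsGT_zero.comp h1).const_mul_atTop hε
        exact h2.comp tendsto_snd
      have hev : ∀ᶠ p : ℝ × ℝ in nhds s0 ×ˢ nhdsWithin 0 (Set.Ioi 0),
          u ∈ cube n (ε / √p.2) := by
        have : ∀ᶠ p : ℝ × ℝ in nhds s0 ×ˢ nhdsWithin 0 (Set.Ioi 0), ∀ i, u i ≤ ε / √p.2 :=
          eventually_all.2 fun i => hdiv.eventually_ge_atTop (u i)
        filter_upwards [this] with p hp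
        exact mem_cube.2 fun i => ⟨hu i, hp i⟩
      have hlim : Tendsto (fun p : ℝ × ℝ => (1 + sqs u) ^ (-p.1))
          (nhds s0 ×ˢ nhdsWithin 0 (Set.Ioi 0)) (nhds ((1 + sqs u) ^ (-s0))) := by
        have hp : 0 < 1 + sqs u := by have := sqs_nonneg u; linarith
        have : Continuous fun s : ℝ => (1 + sqs u) ^ (-s) :=
          continuous_const.rpow continuous_neg fun _ => Or.inl hp.ne'
        exact (this.tendsto s0).comp tendsto_fst
      refine hlim.congr' ?_
      filter_upwards [hev] with p hp
      rw [Set.indicator_of_mem hp]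
    · rw [Set.indicator_of_notMem hu]
      refine tendsto_const_nhds.congr fun p => ?_
      rw [Set.indicator_of_notMem]
      exact fun h => hu fun i => (mem_cube.1 h i).1

lemma inner_eq (n : ℕ) (ε s c : ℝ) (hc : 0 < c) :
    ∫ d in cube n ε, (sqs d + c) ^ (-s) = c ^ (-(s - n / 2)) * gg n ε s c := by
  have hsc : 0 < √c := Real.sqrt_pos.2 hc
  have h := Measure.setIntegral_comp_smul_of_pos (volume : Measure (Fin n → ℝ))
    (fun d => (sqs d + c) ^ (-s)) (cube n (ε / √c)) hsc
  rw [smul_cube _ _ _ hsc, mul_div_cancel₀ _ hsc.ne'] at h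
  have e : ∀ u : Fin n → ℝ, (sqs (√c • u) + c) ^ (-s) = c ^ (-s) * (1 + sqs u) ^ (-s) := by
    intro u
    rw [sqs_smul, Real.sq_sqrt hc.le, ← Real.mul_rpow hc.le (by have := sqs_nonneg u; linarith)]
    congr 1; ring
  simp_rw [e] at h
  rw [integral_const_mul, smul_eq_mul, eq_inv_mul_iff_mul_eq₀ (by positivity)] at h
  rw [← h, gg, ← mul_assoc]
  congr 1
  rw [Module.finrank_fin_fun, Real.sqrt_eq_rpow, ← Real.rpow_natCast, ← Real.rpow_mul hc.le,
    ← Real.rpow_add hc]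
  congr 1; ring

lemma concentrate {X : Type*} [MeasurableSpace X] (μ : Measure X) [IsFiniteMeasure μ]
    (c : X → ℝ) (hc : ∀ᵐ x ∂μ, 0 < c x) (g : ℝ → ℝ → ℝ) (t0 g0 G C : ℝ) (m : ℕ) (hm : m ≠ 0)
    (ht0 : 0 < t0)
    (hint : ∀ t, 0 < t → t < t0 → Integrable (fun x => c x ^ (-t)) μ)
    (hintg : ∀ t, 0 < t → t < t0 → Integrable (fun x => c x ^ (-t) * g t (c x)) μ)
    (hG : ∀ t, t0 / 2 ≤ t → ∀ y, |g t y - g0| ≤ G)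
    (hg : Tendsto (fun p : ℝ × ℝ => g p.1 p.2) (nhds t0 ×ˢ nhdsWithin 0 (Set.Ioi 0)) (nhds g0))
    (hM : Tendsto (fun t => (t0 - t) ^ m * ∫ x, c x ^ (-t) ∂μ) (nhdsWithin t0 (Set.Iio t0))
      (nhds C)) :
    Tendsto (fun t => (t0 - t) ^ m * ∫ x, c x ^ (-t) * g t (c x) ∂μ) (nhdsWithin t0 (Set.Iio t0))
      (nhds (C * g0)) := by
  have hG0 : 0 ≤ G := (abs_nonneg _).trans (hG t0 (by linarith) 0)
  have hrange : ∀ᶠ t in nhdsWithin t0 (Set.Iio t0), t0 / 2 < t ∧ t < t0 := by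
    filter_upwards [self_mem_nhdsWithin, nhdsWithin_le_nhds (lt_mem_nhds (show t0 / 2 < t0 by
      linarith))] with t h1 h2
    exact ⟨h2, h1⟩
  have hpow : Tendsto (fun t => (t0 - t) ^ m) (nhdsWithin t0 (Set.Iio t0)) (nhds 0) := by
    have : Continuous fun t => (t0 - t) ^ m := by fun_prop
    have := this.tendsto t0
    simp only [sub_self, zero_pow hm] at this
    exact this.mono_left nhdsWithin_le_nhds
  suffices h : Tendsto (fun t => (t0 - t) ^ m * ∫ x, c x ^ (-t) * g t (c x) ∂μ
      - ((t0 - t) ^ m * ∫ x, c x ^ (-t) ∂μ) * g0) (nhdsWithin t0 (Set.Iio t0)) (nhds 0) by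
    have := h.add (hM.mul_const g0)
    simpa using this
  rw [Metric.tendsto_nhds]
  intro e he
  obtain ⟨η, hη, hηe⟩ : ∃ η > 0, (|C| + 1) * η < e / 2 := by
    refine ⟨e / 4 / (|C| + 1), by positivity, ?_⟩
    rw [mul_div_cancel₀ _ (by positivity)]; linarith
  have h1 := hg.eventually (Metric.ball_mem_nhds g0 hη)
  obtain ⟨pa, hpa, pb, hpb, hab⟩ := eventually_prod_iff.1 h1
  obtain ⟨r, hr, hr'⟩ := mem_nhdsGT_iff_exists_Ioo_subset.1 hpb
  have hr0 : 0 < r := hr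
  have hM' : ∀ᶠ t in nhdsWithin t0 (Set.Iio t0),
      (t0 - t) ^ m * ∫ x, c x ^ (-t) ∂μ < |C| + 1 :=
    hM.eventually (gt_mem_nhds (by have := le_abs_self C; linarith))
  have hlast : Tendsto (fun t => (t0 - t) ^ m * (G * r ^ (-t) * μ.real Set.univ))
      (nhdsWithin t0 (Set.Iio t0)) (nhds 0) := by
    have : Continuous fun t : ℝ => G * r ^ (-t) * μ.real Set.univ :=
      (continuous_const.mul (continuous_const.rpow continuous_neg fun _ => Or.inl hr0.ne')).mul
        continuous_const
    have := hpow.mul ((this.tendsto t0).mono_left nhdsWithin_le_nhds)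
    simpa using this
  filter_upwards [hrange, nhdsWithin_le_nhds hpa, hM',
    hlast.eventually (gt_mem_nhds (show 0 < e / 2 by linarith))] with t ht hpt hMt hl
  have htp : 0 < t := by linarith
  have hi := hint t htp ht.2
  have hig := hintg t htp ht.2
  have hbd : |∫ x, c x ^ (-t) * g t (c x) ∂μ - (∫ x, c x ^ (-t) ∂μ) * g0|
      ≤ η * (∫ x, c x ^ (-t) ∂μ) + G * r ^ (-t) * μ.real Set.univ := by
    rw [← integral_mul_const, ← integral_sub hig (hi.mul_const _)]
    have : η * (∫ x, c x ^ (-t) ∂μ) + G * r ^ (-t) * μ.real Set.univ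
        = ∫ x, (η * c x ^ (-t) + G * r ^ (-t)) ∂μ := by
      rw [integral_add (hi.const_mul _) (integrable_const _), integral_const_mul, integral_const,
        smul_eq_mul]
      ring
    rw [this, ← Real.norm_eq_abs]
    refine norm_integral_le_of_norm_le ((hi.const_mul _).add (integrable_const _)) ?_
    filter_upwards [hc] with x hx
    have hcp : 0 < c x ^ (-t) := Real.rpow_pos_of_pos hx _
    have hrp : 0 < r ^ (-t) := Real.rpow_pos_of_pos hr0 _
    rw [← mul_sub, Real.norm_eq_abs, abs_mul, abs_of_pos hcp]
    rcases lt_or_ge (c x) r with hxr | hxr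
    · have h2 : |g t (c x) - g0| < η := by
        have := hab hpt (hr' ⟨hx, hxr⟩)
        simpa [Real.dist_eq] using this
      have : c x ^ (-t) * |g t (c x) - g0| ≤ c x ^ (-t) * η := by gcongr
      have : 0 ≤ G * r ^ (-t) := by positivity
      linarith
    · have h2 := hG t ht.1.le (c x)
      have h3 : c x ^ (-t) ≤ r ^ (-t) := Real.rpow_le_rpow_of_nonpos hr0 hxr (by linarith)
      have : c x ^ (-t) * |g t (c x) - g0| ≤ r ^ (-t) * G := by gcongr
      have : 0 ≤ η * c x ^ (-t) := by positivity
      linarith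
  rw [Real.dist_eq, sub_zero, mul_assoc, ← mul_sub, abs_mul,
    abs_of_nonneg (pow_nonneg (sub_nonneg.2 ht.2.le) m)]
  have hp0 : 0 ≤ (t0 - t) ^ m := pow_nonneg (sub_nonneg.2 ht.2.le) m
  have := mul_le_mul_of_nonneg_left hbd hp0
  have h5 : (t0 - t) ^ m * (∫ x, c x ^ (-t) ∂μ) * η ≤ (|C| + 1) * η := by gcongr
  linarith

/-- reordering of coordinates -/
def reo (n : ℕ) : (ℝ × (Fin n → ℝ)) × (Fin n → ℝ) ≃ᵐ ℝ × (Fin n → ℝ) × (Fin n → ℝ) :=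
  MeasurableEquiv.prodAssoc.trans
    (MeasurableEquiv.prodCongr (MeasurableEquiv.refl ℝ) MeasurableEquiv.prodComm)

/-- prior on `(a, β)` -/
noncomputable def am (n : ℕ) (ε : ℝ) : Measure (ℝ × (Fin n → ℝ)) :=
  (volume.restrict (Set.Icc 0 ε)).prod (volume.restrict (cube n ε))

instance (n : ℕ) (ε : ℝ) : IsFiniteMeasure (am n ε) := by unfold am; infer_instance

lemma reo_mp (n : ℕ) (ε : ℝ) :
    MeasurePreserving (reo n) ((am n ε).prod (volume.restrict (cube n ε))) (bm n ε) := by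
  have h1 := measurePreserving_prodAssoc ((volume : Measure ℝ).restrict (Set.Icc 0 ε))
    (volume.restrict (cube n ε)) (volume.restrict (cube n ε))
  have h2 := (MeasurePreserving.id ((volume : Measure ℝ).restrict (Set.Icc 0 ε))).prod
    (Measure.measurePreserving_swap (μ := volume.restrict (cube n ε))
      (ν := volume.restrict (cube n ε)))
  exact h2.comp h1

/-- reduced function of `(a, β)` -/
def cc {n : ℕ} (p : ℝ × (Fin n → ℝ)) : ℝ := p.1 ^ 2 * quart p.2

lemma am_pos (n : ℕ) (ε : ℝ) : ∀ᵐ v ∂(am n ε), 0 < v.1 ∧ ∀ i, 0 < v.2 i := by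
  have h1 : ∀ᵐ v ∂(am n ε), 0 < v.1 ∧ v.1 ≤ ε := Measure.quasiMeasurePreserving_fst.ae (icc_pos ε)
  have h2 : ∀ᵐ v ∂(am n ε), ∀ i, 0 < v.2 i ∧ v.2 i ≤ ε :=
    Measure.quasiMeasurePreserving_snd.ae (cube_pos n ε)
  filter_upwards [h1, h2] with v h1 h2
  exact ⟨h1.1, fun i => (h2 i).1⟩

lemma cc_pos (n : ℕ) (hn : 1 ≤ n) (ε : ℝ) : ∀ᵐ v ∂(am n ε), 0 < cc v := by
  filter_upwards [am_pos n ε] with v hv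
  have := quart_pos hn v.2 hv.2
  have := hv.1
  unfold cc; positivity

lemma fubini (n : ℕ) (hn : 1 ≤ n) (ε s : ℝ) (hε : 0 < ε) (hs : s < n / 2 + mu0 n) :
    Integrable (fun p => cc p ^ (-(s - n / 2)) * gg n ε s (cc p)) (am n ε) ∧
    ∫ v, KK v ^ (-s) ∂(bm n ε) = ∫ p, cc p ^ (-(s - n / 2)) * gg n ε s (cc p) ∂(am n ε) := by
  have hI := KK_int n hn ε (-s) hε (by linarith)
  have hI2 : Integrable (fun q => KK (reo n q) ^ (-s))
      ((am n ε).prod (volume.restrict (cube n ε))) :=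
    ((reo_mp n ε).integrable_comp_emb (reo n).measurableEmbedding).2 hI
  have hae : (fun p => ∫ d in cube n ε, KK (reo n (p, d)) ^ (-s)) =ᵐ[am n ε]
      fun p => cc p ^ (-(s - n / 2)) * gg n ε s (cc p) := by
    filter_upwards [cc_pos n hn ε] with p hp
    rw [← inner_eq n ε s _ hp]
    rfl
  constructor
  · exact hI2.integral_prod_left.congr hae
  · rw [← (reo_mp n ε).integral_comp' (fun v => KK v ^ (-s)), integral_prod _ hI2]
    exact integral_congr_ae hae

/-- integral of `quart ^ (-t)` -/
noncomputable def JJ (n : ℕ) (ε t : ℝ) : ℝ := ∫ x in cube n ε, quart x ^ (-t)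

/-- integral over the shell -/
noncomputable def HH (n : ℕ) (ε t : ℝ) : ℝ := ∫ x in cube n ε \ cube n (ε / 2), quart x ^ (-t)

lemma half_cube_subset (n : ℕ) (ε : ℝ) (hε : 0 < ε) : cube n (ε / 2) ⊆ cube n ε := by
  intro x hx
  refine mem_cube.2 fun i => ?_
  have := mem_cube.1 hx i
  exact ⟨this.1, this.2.trans (by linarith)⟩

lemma JJ_half (n : ℕ) (ε t : ℝ) :
    JJ n (ε / 2) t = (2 : ℝ) ^ (4 * t - n) * JJ n ε t := by
  have h := Measure.setIntegral_comp_smul_of_pos (volume : Measure (Fin n → ℝ))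
    (fun d => quart d ^ (-t)) (cube n ε) (show (0 : ℝ) < 2⁻¹ by norm_num)
  rw [smul_cube _ _ _ (by norm_num)] at h
  have e : ∀ u : Fin n → ℝ, quart ((2⁻¹ : ℝ) • u) ^ (-t) = (2 : ℝ) ^ (4 * t) * quart u ^ (-t) := by
    intro u
    rw [quart_smul, Real.mul_rpow (by positivity) (quart_nonneg u), pow_rpow_neg _ _ _ (by norm_num),
      Real.inv_rpow (by norm_num), ← Real.rpow_neg (by norm_num), neg_neg]
    norm_num
  simp_rw [e] at h
  rw [integral_const_mul, smul_eq_mul, eq_inv_mul_iff_mul_eq₀ (by positivity)] at h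
  have e3 : ε / 2 = 2⁻¹ * ε := by ring
  rw [e3, JJ, ← h, JJ, ← mul_assoc]
  congr 1
  rw [Module.finrank_fin_fun, Real.rpow_sub (by norm_num), Real.rpow_natCast, inv_pow]
  ring

lemma JJ_HH (n : ℕ) (hn : 1 ≤ n) (ε t : ℝ) (hε : 0 < ε) (ht : 0 ≤ t) (ht' : t < n / 4) :
    JJ n ε t * (1 - (2 : ℝ) ^ (4 * t - n)) = HH n ε t := by
  have h := setIntegral_sdiff (μ := volume) (meas_cube n (ε / 2))
    (quart_int n hn ε t hε ht ht') (half_cube_subset n ε hε)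
  have h2 := JJ_half n ε t
  unfold HH
  rw [h]
  unfold JJ at *
  rw [h2]; ring

lemma shell_lower {n : ℕ} {ε : ℝ} (hε : 0 < ε) {x : Fin n → ℝ}
    (hx : x ∈ cube n ε \ cube n (ε / 2)) : (ε / 2) ^ 4 ≤ quart x := by
  have h1 := mem_cube.1 hx.1
  have h2 := hx.2
  rw [mem_cube] at h2
  push Not at h2
  obtain ⟨i, hi⟩ := h2
  have h3 : ε / 2 < x i := by
    by_contra hcon
    exact hi ⟨(h1 i).1, not_lt.1 hcon⟩
  calc (ε / 2) ^ 4 ≤ x i ^ 4 := by gcongr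
    _ ≤ _ := le_quart x i

lemma shell_meas (n : ℕ) (ε : ℝ) : MeasurableSet (cube n ε \ cube n (ε / 2)) :=
  (meas_cube _ _).diff (meas_cube _ _)

instance (n : ℕ) (ε : ℝ) : IsFiniteMeasure
    ((volume : Measure (Fin n → ℝ)).restrict (cube n ε \ cube n (ε / 2))) :=
  ⟨by rw [Measure.restrict_apply_univ]
      exact (measure_mono Set.sdiff_subset).trans_lt (isCompact_cube n ε).measure_lt_top⟩

lemma quart_rpow_meas (n : ℕ) (t : ℝ) : Measurable (fun x : Fin n → ℝ => quart x ^ (-t)) :=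
  (quart_cont n).measurable.pow_const _

lemma shell_bound {n : ℕ} {ε : ℝ} (hε : 0 < ε) {x : Fin n → ℝ} {t T : ℝ} (ht : 0 ≤ t) (hT : t ≤ T)
    (hx : x ∈ cube n ε \ cube n (ε / 2)) :
    quart x ^ (-t) ≤ max 1 (((ε / 2) ^ 4) ^ (-T)) := by
  have hp : 0 < (ε / 2) ^ 4 := by positivity
  refine (Real.rpow_le_rpow_of_nonpos hp (shell_lower hε hx) (by linarith)).trans ?_
  rcases le_total 1 ((ε / 2) ^ 4) with h | h
  · exact le_max_of_le_left (Real.rpow_le_one_of_one_le_of_nonpos h (by linarith))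
  · exact le_max_of_le_right (Real.rpow_le_rpow_of_exponent_ge hp h (by linarith))

lemma HH_tendsto (n : ℕ) (ε t0 : ℝ) (hε : 0 < ε) (ht0 : 0 < t0) :
    Tendsto (HH n ε) (nhds t0) (nhds (HH n ε t0)) := by
  unfold HH
  refine tendsto_integral_filter_of_dominated_convergence
    (fun _ => max 1 (((ε / 2) ^ 4) ^ (-(t0 + 1)))) ?_ ?_ (integrable_const _) ?_
  · exact Eventually.of_forall fun t => (quart_rpow_meas n t).aestronglyMeasurable
  · filter_upwards [lt_mem_nhds ht0, gt_mem_nhds (show t0 < t0 + 1 by linarith)] with t h1 h2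
    filter_upwards [ae_restrict_mem (shell_meas n ε)] with x hx
    rw [Real.norm_of_nonneg (Real.rpow_nonneg (quart_nonneg x) _)]
    exact shell_bound hε h1.le h2.le hx
  · filter_upwards [ae_restrict_mem (shell_meas n ε)] with x hx
    have hp : 0 < quart x := lt_of_lt_of_le (by positivity) (shell_lower hε hx)
    have : Continuous fun s : ℝ => quart x ^ (-s) :=
      continuous_const.rpow continuous_neg fun _ => Or.inl hp.ne'
    exact this.tendsto t0

lemma HH_pos (n : ℕ) (hn : 1 ≤ n) (ε t : ℝ) (hε : 0 < ε) (ht : 0 ≤ t) : 0 < HH n ε t := by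
  unfold HH
  have hint : IntegrableOn (fun x : Fin n → ℝ => quart x ^ (-t)) (cube n ε \ cube n (ε / 2)) := by
    refine (integrable_const (max 1 (((ε / 2) ^ 4) ^ (-t)))).mono'
      (quart_rpow_meas n t).aestronglyMeasurable ?_
    filter_upwards [ae_restrict_mem (shell_meas n ε)] with x hx
    rw [Real.norm_of_nonneg (Real.rpow_nonneg (quart_nonneg x) _)]
    exact shell_bound hε ht le_rfl hx
  rw [setIntegral_pos_iff_support_of_nonneg_ae
    (Eventually.of_forall fun u => Real.rpow_nonneg (quart_nonneg u) _) hint]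
  have : cube n ε \ cube n (ε / 2) ⊆ Function.support (fun x : Fin n → ℝ => quart x ^ (-t))
      ∩ (cube n ε \ cube n (ε / 2)) := by
    intro x hx
    have hp : 0 < quart x := lt_of_lt_of_le (by positivity) (shell_lower hε hx)
    exact ⟨(Real.rpow_pos_of_pos hp _).ne', hx⟩
  refine lt_of_lt_of_le ?_ (measure_mono this)
  rw [measure_sdiff (half_cube_subset n ε hε) (meas_cube _ _).nullMeasurableSet
    (isCompact_cube _ _).measure_lt_top.ne, tsub_pos_iff_lt, volume_cube, volume_cube]
  have hlt : ENNReal.ofReal (ε / 2) < ENNReal.ofReal ε := by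
    rw [ENNReal.ofReal_lt_ofReal_iff hε]; linarith
  have hn0 : n ≠ 0 := by omega
  first
    | exact ENNReal.pow_lt_pow_left hlt hn0
    | exact ENNReal.pow_lt_pow_left hn0 hlt

lemma two_pow_lt {n : ℕ} {t : ℝ} (h : t < n / 4) : (2 : ℝ) ^ (4 * t - n) < 1 :=
  Real.rpow_lt_one_of_one_lt_of_neg (by norm_num) (by linarith)

lemma range_ev {t0 : ℝ} (ht0 : 0 < t0) : ∀ᶠ t in nhdsWithin t0 (Set.Iio t0), 0 < t ∧ t < t0 := by
  filter_upwards [self_mem_nhdsWithin, nhdsWithin_le_nhds (lt_mem_nhds ht0)] with t h1 h2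
  exact ⟨h2, h1⟩

lemma two_cont (n : ℕ) : Continuous fun t : ℝ => (2 : ℝ) ^ (4 * t - n) :=
  continuous_const.rpow (by fun_prop) fun _ => Or.inl (by norm_num)

lemma JJ_regular (n : ℕ) (hn : 1 ≤ n) (ε t0 : ℝ) (hε : 0 < ε) (ht0 : 0 < t0) (h : t0 < n / 4) :
    ∃ C > 0, Tendsto (JJ n ε) (nhdsWithin t0 (Set.Iio t0)) (nhds C) := by
  have h1 := two_pow_lt h
  refine ⟨HH n ε t0 / (1 - (2 : ℝ) ^ (4 * t0 - n)), div_pos (HH_pos n hn ε t0 hε ht0.le)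
    (by linarith), ?_⟩
  have := ((HH_tendsto n ε t0 hε ht0).div ((tendsto_const_nhds (x := (1 : ℝ))).sub
    ((two_cont n).tendsto t0)) (by linarith)).mono_left
    (nhdsWithin_le_nhds (s := Set.Iio t0))
  refine this.congr' ?_
  filter_upwards [range_ev ht0] with t ht
  have h2 := two_pow_lt (ht.2.trans h)
  simp only [Pi.div_apply]
  rw [← JJ_HH n hn ε t hε ht.1.le (ht.2.trans h)]
  rw [mul_div_cancel_right₀]; linarith

lemma JJ_pole (n : ℕ) (hn : 1 ≤ n) (ε t0 : ℝ) (hε : 0 < ε) (h : t0 = n / 4) :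
    ∃ C > 0, Tendsto (fun t => (t0 - t) * JJ n ε t) (nhdsWithin t0 (Set.Iio t0)) (nhds C) := by
  have hn' : (0 : ℝ) < n := by exact_mod_cast hn
  have ht0 : 0 < t0 := by rw [h]; positivity
  have hlog : 0 < Real.log 2 := Real.log_pos (by norm_num)
  have hd : HasDerivAt (fun t : ℝ => (2 : ℝ) ^ (4 * t - n)) (4 * Real.log 2) t0 := by
    have h1 : HasDerivAt (fun t : ℝ => 4 * t - n) 4 t0 := by
      simpa using ((hasDerivAt_id t0).const_mul 4).sub_const (n : ℝ)
    have := h1.const_rpow (a := 2) (by norm_num)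
    convert this using 1
    have : 4 * t0 - n = 0 := by rw [h]; ring
    rw [this]; simp; ring
  have hs := (hasDerivAt_iff_tendsto_slope.1 hd).mono_left
    (nhdsWithin_mono t0 (fun x (hx : x ∈ Set.Iio t0) => (ne_of_lt hx)))
  have hs2 := ((HH_tendsto n ε t0 hε ht0).mono_left
    (nhdsWithin_le_nhds (s := Set.Iio t0))).div hs (by positivity)
  refine ⟨_, div_pos (HH_pos n hn ε t0 hε ht0.le) (by positivity), hs2.congr' ?_⟩
  filter_upwards [range_ev ht0] with t ht
  have h2 := two_pow_lt (h ▸ ht.2 : t < n / 4)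
  simp only [Pi.div_apply]
  rw [← JJ_HH n hn ε t hε ht.1.le (h ▸ ht.2), slope_def_field]
  have : 4 * t0 - n = 0 := by rw [h]; ring
  rw [this, Real.rpow_zero]
  have e1 : (2 : ℝ) ^ (4 * t - n) - 1 ≠ 0 := by linarith
  have e2 : t - t0 ≠ 0 := by linarith [ht.2]
  field_simp
  ring

/-- integral in `a` -/
noncomputable def AA (ε t : ℝ) : ℝ := ∫ a in Set.Icc 0 ε, a ^ (-(2 * t))

lemma AA_eq (ε t : ℝ) (hε : 0 < ε) (ht : t < 1 / 2) :
    AA ε t = ε ^ (1 - 2 * t) / (1 - 2 * t) := by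
  unfold AA
  rw [integral_Icc_eq_integral_Ioc, ← intervalIntegral.integral_of_le hε.le,
    integral_rpow (Or.inl (by linarith)), Real.zero_rpow (by linarith)]
  rw [sub_zero, show -(2 * t) + 1 = 1 - 2 * t by ring]

lemma eps_cont (ε : ℝ) (hε : 0 < ε) : Continuous fun t : ℝ => ε ^ (1 - 2 * t) :=
  continuous_const.rpow (by fun_prop) fun _ => Or.inl hε.ne'

lemma AA_regular (ε t0 : ℝ) (hε : 0 < ε) (h : t0 < 1 / 2) :
    ∃ C > 0, Tendsto (AA ε) (nhdsWithin t0 (Set.Iio t0)) (nhds C) := by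
  refine ⟨ε ^ (1 - 2 * t0) / (1 - 2 * t0), div_pos (Real.rpow_pos_of_pos hε _) (by linarith), ?_⟩
  have hc : Continuous fun t : ℝ => 1 - 2 * t := by fun_prop
  have := (((eps_cont ε hε).tendsto t0).div (hc.tendsto t0) (by linarith)).mono_left
    (nhdsWithin_le_nhds (s := Set.Iio t0))
  refine this.congr' ?_
  filter_upwards [self_mem_nhdsWithin] with t ht
  rw [AA_eq ε t hε (lt_trans ht h)]; rfl

lemma AA_pole (ε t0 : ℝ) (hε : 0 < ε) (h : t0 = 1 / 2) :
    ∃ C > 0, Tendsto (fun t => (t0 - t) * AA ε t) (nhdsWithin t0 (Set.Iio t0)) (nhds C) := by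
  refine ⟨ε ^ (1 - 2 * t0) / 2, div_pos (Real.rpow_pos_of_pos hε _) (by linarith), ?_⟩
  have := (((eps_cont ε hε).tendsto t0).div_const 2).mono_left
    (nhdsWithin_le_nhds (s := Set.Iio t0))
  refine this.congr' ?_
  filter_upwards [self_mem_nhdsWithin] with t ht
  have ht' : t < 1 / 2 := h ▸ ht
  rw [AA_eq ε t hε ht', h]
  have : 1 - 2 * t ≠ 0 := by linarith
  field_simp

lemma cc_rpow (n : ℕ) (ε t : ℝ) : (fun p => cc p ^ (-t)) =ᵐ[am n ε]
    fun p => p.1 ^ (-(2 * t)) * quart p.2 ^ (-t) := by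
  filter_upwards [am_pos n ε] with p hp
  unfold cc
  rw [Real.mul_rpow (by positivity) (quart_nonneg _), pow_rpow_neg _ _ _ hp.1.le]
  norm_num

lemma cc_int (n : ℕ) (hn : 1 ≤ n) (ε t : ℝ) (hε : 0 < ε) (ht : 0 < t) (ht' : t < mu0 n) :
    Integrable (fun p => cc p ^ (-t)) (am n ε) := by
  have h1 : t < 1 / 2 := ht'.trans_le (min_le_left _ _)
  have h2 : t < n / 4 := ht'.trans_le (min_le_right _ _)
  exact ((icc_int ε (2 * t) hε (by linarith)).mul_prod (quart_int n hn ε t hε ht.le h2)).congr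
    (cc_rpow n ε t).symm

lemma cc_integral (n : ℕ) (ε t : ℝ) : ∫ p, cc p ^ (-t) ∂(am n ε) = AA ε t * JJ n ε t := by
  rw [integral_congr_ae (cc_rpow n ε t), am,
    integral_prod_mul (fun a : ℝ => a ^ (-(2 * t))) (fun x => quart x ^ (-t))]
  rfl

lemma cc_limit (n : ℕ) (hn : 1 ≤ n) (ε : ℝ) (hε : 0 < ε) (m : ℕ)
    (hm : m = if n = 2 then 2 else 1) :
    ∃ C > 0, Tendsto (fun t => (mu0 n - t) ^ m * ∫ p, cc p ^ (-t) ∂(am n ε))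
      (nhdsWithin (mu0 n) (Set.Iio (mu0 n))) (nhds C) := by
  simp_rw [cc_integral]
  have hm0 := mu0_pos hn
  rcases lt_trichotomy n 2 with h | h | h
  · have : n = 1 := by omega
    subst this
    have e : mu0 1 = 1 / 4 := by unfold mu0; norm_num
    obtain ⟨C1, hC1, h1⟩ := AA_regular ε (mu0 1) hε (by rw [e]; norm_num)
    obtain ⟨C2, hC2, h2⟩ := JJ_pole 1 hn ε (mu0 1) hε (by rw [e]; norm_num)
    refine ⟨C1 * C2, by positivity, (h1.mul h2).congr fun t => ?_⟩
    rw [hm]; norm_num; ring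
  · subst h
    have e : mu0 2 = 1 / 2 := by unfold mu0; norm_num
    obtain ⟨C1, hC1, h1⟩ := AA_pole ε (mu0 2) hε e
    obtain ⟨C2, hC2, h2⟩ := JJ_pole 2 hn ε (mu0 2) hε (by rw [e]; norm_num)
    refine ⟨C1 * C2, by positivity, (h1.mul h2).congr fun t => ?_⟩
    rw [hm]; norm_num; ring
  · have h3 : (3 : ℝ) ≤ n := by exact_mod_cast h
    have e : mu0 n = 1 / 2 := by unfold mu0; rw [min_eq_left]; linarith
    obtain ⟨C1, hC1, h1⟩ := AA_pole ε (mu0 n) hε e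
    obtain ⟨C2, hC2, h2⟩ := JJ_regular n hn ε (mu0 n) hε hm0 (by rw [e]; linarith)
    refine ⟨C1 * C2, by positivity, (h1.mul h2).congr fun t => ?_⟩
    rw [hm, if_neg (by omega)]; ring

lemma main_limit (n : ℕ) (hn : 1 ≤ n) (ε : ℝ) (hε : 0 < ε) (m : ℕ)
    (hm : m = if n = 2 then 2 else 1) :
    ∃ C > 0, Tendsto (fun z => (z + (n / 2 + mu0 n)) ^ m * ∫ v, KK v ^ z ∂(bm n ε))
      (nhdsWithin (-(n / 2 + mu0 n)) (Set.Ioi (-(n / 2 + mu0 n)))) (nhds C) := by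
  obtain ⟨C, hC, hlim⟩ := cc_limit n hn ε hε m hm
  have hm0 := mu0_pos hn
  have hG := G0_pos n (n / 2 + mu0 n) (by linarith)
  refine ⟨C * G0 n (n / 2 + mu0 n), by positivity, ?_⟩
  have hconc := concentrate (am n ε) cc (cc_pos n hn ε) (fun t c => gg n ε (t + n / 2) c)
    (mu0 n) (G0 n (n / 2 + mu0 n))
    ((∫ u : Fin n → ℝ, (1 + sqs u) ^ (-(n / 2 + mu0 n / 2))) + G0 n (n / 2 + mu0 n)) C m
    (by rw [hm]; split_ifs <;> norm_num) hm0
    (fun t h1 h2 => cc_int n hn ε t hε h1 h2)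
    (fun t h1 h2 => by
      have := (fubini n hn ε (t + n / 2) hε (by linarith)).1
      simpa using this)
    (fun t ht y => by
      have h1 := gg_nonneg n ε (t + n / 2) y
      have h2 := gg_le n ε (t + n / 2) (n / 2 + mu0 n / 2) y (by linarith) (by linarith)
      rw [abs_le]; constructor <;> linarith)
    (by
      have h := gg_tendsto n ε (n / 2 + mu0 n) hε (by linarith)
      have h1 : Tendsto (fun t : ℝ => t + n / 2) (nhds (mu0 n)) (nhds (n / 2 + mu0 n)) := by
        have : Continuous fun t : ℝ => t + n / 2 := by fun_prop
        have := this.tendsto (mu0 n)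
        rwa [add_comm (mu0 n)] at this
      exact h.comp (h1.prodMap tendsto_id)) hlim
  have hmap : Tendsto (fun z : ℝ => -z - n / 2)
      (nhdsWithin (-(n / 2 + mu0 n)) (Set.Ioi (-(n / 2 + mu0 n))))
      (nhdsWithin (mu0 n) (Set.Iio (mu0 n))) := by
    refine tendsto_nhdsWithin_of_tendsto_nhds_of_eventually_within _ ?_ ?_
    · have : Continuous fun z : ℝ => -z - n / 2 := by fun_prop
      have := this.tendsto (-(n / 2 + mu0 n))
      rw [show - -(n / 2 + mu0 n) - n / 2 = mu0 n by ring] at this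
      exact this.mono_left nhdsWithin_le_nhds
    · filter_upwards [self_mem_nhdsWithin] with z hz
      have : -(n / 2 + mu0 n) < z := hz
      show -z - n / 2 < mu0 n
      linarith
  refine (hconc.comp hmap).congr' ?_
  filter_upwards [self_mem_nhdsWithin] with z hz
  have hz' : -(n / 2 + mu0 n) < z := hz
  have hf := (fubini n hn ε (-z) hε (by linarith)).2
  rw [neg_neg] at hf
  simp only [Function.comp_apply]
  rw [hf]
  congr 2
  · ring
  · simp

lemma main_not_int (n : ℕ) (hn : 1 ≤ n) (ε z : ℝ) (hε : 0 < ε) (hz : z ≤ -(n / 2 + mu0 n)) :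
    ¬ Integrable (fun v => KK v ^ z) (bm n ε) := by
  intro hI
  have hm0 := mu0_pos hn
  have hn' : (0 : ℝ) < n := by exact_mod_cast hn
  obtain ⟨C, hC, hlim⟩ := main_limit n hn ε hε _ rfl
  obtain ⟨M, hM1, hM⟩ := KK_bdd n ε
  set lam : ℝ := n / 2 + mu0 n with hlam
  have hl : 0 < lam := by positivity
  set m : ℕ := if n = 2 then 2 else 1 with hmdef
  have hmne : m ≠ 0 := by rw [hmdef]; split_ifs <;> norm_num
  set D : ℝ := M ^ (-z) * ∫ v, KK v ^ z ∂(bm n ε) with hD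
  have hup : Tendsto (fun w : ℝ => (w + lam) ^ m * D) (nhdsWithin (-lam) (Set.Ioi (-lam)))
      (nhds 0) := by
    have : Continuous fun w : ℝ => (w + lam) ^ m * D := by fun_prop
    have := this.tendsto (-lam)
    simp only [neg_add_cancel, zero_pow hmne, zero_mul] at this
    exact this.mono_left nhdsWithin_le_nhds
  have hle : C ≤ 0 := by
    refine le_of_tendsto_of_tendsto hlim hup ?_
    filter_upwards [self_mem_nhdsWithin,
      nhdsWithin_le_nhds (gt_mem_nhds (show -lam < 0 by linarith))] with w hw hw0
    have hw' : -lam < w := hw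
    refine mul_le_mul_of_nonneg_left ?_ (pow_nonneg (by linarith) m)
    rw [hD, ← integral_const_mul]
    refine integral_mono_ae (KK_int n hn ε w hε hw') (hI.const_mul _) ?_
    filter_upwards [hM] with v hv
    rcases (KK_nonneg v).eq_or_lt with h0 | h0
    · show KK v ^ w ≤ M ^ (-z) * KK v ^ z
      rw [← h0, Real.zero_rpow hw0.ne, Real.zero_rpow (by linarith)]; simp
    · show KK v ^ w ≤ M ^ (-z) * KK v ^ z
      have e : KK v ^ w = KK v ^ (w - z) * KK v ^ z := by
        rw [← Real.rpow_add h0]; congr 1; ring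
      rw [e]
      refine mul_le_mul_of_nonneg_right ?_ (Real.rpow_nonneg h0.le _)
      exact (Real.rpow_le_rpow h0.le hv (by linarith)).trans
        (Real.rpow_le_rpow_of_exponent_le hM1 (by linarith))
  linarith

lemma rlct_core (n : ℕ) (hn : 1 ≤ n) (ε : ℝ) (hε : 0 < ε) (lam : ℝ) (hlam : lam = n / 2 + mu0 n)
    (m : ℕ) (hm : m = if n = 2 then 2 else 1)
    (S : Set (ℝ × (Fin n → ℝ) × (Fin n → ℝ)))
    (hS : S = {v | v.1 ∈ Set.Icc 0 ε ∧ (∀ l, v.2.1 l ∈ Set.Icc 0 ε) ∧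
            (∀ l, v.2.2 l ∈ Set.Icc 0 ε)})
    (K3 : ℝ × (Fin n → ℝ) × (Fin n → ℝ) → ℝ)
    (hK : K3 = (fun v => ∑ l, v.2.1 l ^ 2 + v.1 ^ 2 * ∑ l, v.2.2 l ^ 4)) :
    (∀ z : ℝ, -lam < z → IntegrableOn (fun v => K3 v ^ z) S volume) ∧
    (∀ z : ℝ, z ≤ -lam → ¬ IntegrableOn (fun v => K3 v ^ z) S volume) ∧
    ∃ C : ℝ, 0 < C ∧
      Tendsto (fun z : ℝ => (z + lam) ^ m * ∫ v in S, K3 v ^ z ∂volume)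
        (nhdsWithin (-lam) (Set.Ioi (-lam))) (nhds C) := by
  have hS' : S = Set.Icc 0 ε ×ˢ (cube n ε ×ˢ cube n ε) := by
    rw [hS]; ext v; simp only [Set.mem_prod, mem_cube]; rfl
  have hK' : K3 = KK := hK
  subst hlam
  unfold IntegrableOn
  rw [hS', hK', ← bm_eq]
  exact ⟨fun z hz => KK_int n hn ε z hε hz, fun z hz => main_not_int n hn ε z hε hz,
    main_limit n hn ε hε m hm⟩

/-- RLCT of `K₃(v) = Σ δ_ℓ^2 + a^2 Σ β_ℓ^4` over a small box
`[0,ε]^{2L−1}` with flat prior: the zeta function `ζ(z) = ∫ K₃(v)^z dv` converges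
exactly for `z > −λ` with `λ = (L−1)/2 + min(1/2, (L−1)/4)`, and has largest pole
at `z = −λ` of order `m = 2` if `L = 3` and `m = 1` otherwise, in the sense that
`(z+λ)^m ζ(z)` tends to a positive constant as `z → −λ⁺`. -/
theorem rlct_K3_flat_prior (L : ℕ) (hL : 2 ≤ L) (ε : ℝ) (hε : 0 < ε) :
    ∀ lam : ℝ, lam = ((L : ℝ) - 1) / 2 + min (1 / 2) (((L : ℝ) - 1) / 4) →
    ∀ m : ℕ, m = (if L = 3 then 2 else 1) →
    ∀ S : Set (ℝ × (Fin (L - 1) → ℝ) × (Fin (L - 1) → ℝ)),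
      S = {v | v.1 ∈ Set.Icc 0 ε ∧ (∀ ℓ, v.2.1 ℓ ∈ Set.Icc 0 ε) ∧
            (∀ ℓ, v.2.2 ℓ ∈ Set.Icc 0 ε)} →
    ∀ K3 : ℝ × (Fin (L - 1) → ℝ) × (Fin (L - 1) → ℝ) → ℝ,
      K3 = (fun v => ∑ ℓ, v.2.1 ℓ ^ 2 + v.1 ^ 2 * ∑ ℓ, v.2.2 ℓ ^ 4) →
    (∀ z : ℝ, -lam < z → IntegrableOn (fun v => K3 v ^ z) S volume) ∧
    (∀ z : ℝ, z ≤ -lam → ¬ IntegrableOn (fun v => K3 v ^ z) S volume) ∧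
    ∃ C : ℝ, 0 < C ∧
      Tendsto (fun z : ℝ => (z + lam) ^ m * ∫ v in S, K3 v ^ z ∂volume)
        (nhdsWithin (-lam) (Set.Ioi (-lam))) (nhds C) := by
  intro lam hlam m hm S hS K3 hK
  obtain ⟨n, rfl⟩ : ∃ n, L = n + 1 := ⟨L - 1, by omega⟩
  refine rlct_core n (by omega) ε hε lam ?_ m ?_ S hS K3 hK
  · rw [hlam, mu0]; push_cast; simp
  · rw [hm]; simp
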